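/- (Exact second moment of the partial coupled-sum estimator) Let (S_α)_{α ∈ ℕ^d} be square-integrable real random variables, let n ∈ ℕ, and let N be an ℕ^d-valued random variable independent of the family (S_α), with P(N ≥ α) > 0 for all α ∈ I_0^n. Then the partial estimator Z̄_n = Σ_{α ∈ I_0^n} ΔS_α · 1_{{N ≥ α}} / P(N ≥ α) satisfies E[Z̄_n²] = Σ_{α, β ∈ I_0^n} E[ΔS_α ΔS_β] · P(N ≥ α ∨ β) / (P(N ≥ α) P(N ≥ β)). -/

import Mathlib

open MeasureTheory ProbabilityTheory

/-- The `i`-th difference operator: `(Δ_i S)_α = S_α − S_{α−e_i}` if `α_i > 0`,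
and `(Δ_i S)_α = S_α` if `α_i = 0`. -/
def diffOp {d : ℕ} {V : Type*} [AddCommGroup V] [Module ℝ V]
    (i : Fin d) (S : (Fin d → ℕ) → V) : (Fin d → ℕ) → V :=
  fun α => if α i = 0 then S α else S α - S (Function.update α i (α i - 1))

/-- The mixed difference operator `Δ = Δ_1 ∘ ⋯ ∘ Δ_d`. -/
def mixedDiff {d : ℕ} {V : Type*} [AddCommGroup V] [Module ℝ V]
    (S : (Fin d → ℕ) → V) : (Fin d → ℕ) → V :=
  (List.finRange d).foldr (fun i T => diffOp i T) S

theorem measurable_diffOp_foldr {d : ℕ} (l : List (Fin d)) (α : Fin d → ℕ) :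
    Measurable fun x : (Fin d → ℕ) → ℝ => l.foldr (fun i T => diffOp i T) x α := by
  induction l generalizing α with
  | nil => exact measurable_pi_apply α
  | cons i l ih =>
    by_cases h : α i = 0
    · simpa [diffOp, h] using ih α
    · simpa [diffOp, h, Pi.sub_def] using (ih α).sub (ih _)

theorem measurable_mixedDiff {d : ℕ} (α : Fin d → ℕ) :
    Measurable fun x : (Fin d → ℕ) → ℝ => mixedDiff x α :=
  measurable_diffOp_foldr _ α

theorem memLp_diffOp_foldr {d : ℕ} {Ω : Type*} [MeasurableSpace Ω] {μ : Measure Ω}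
    {p : ENNReal} {S : (Fin d → ℕ) → Ω → ℝ} (hS : ∀ α, MemLp (S α) p μ)
    (l : List (Fin d)) (α : Fin d → ℕ) :
    MemLp (fun ω => l.foldr (fun i T => diffOp i T) (fun β => S β ω) α) p μ := by
  induction l generalizing α with
  | nil => exact hS α
  | cons i l ih =>
    by_cases h : α i = 0
    · simpa [diffOp, h] using ih α
    · simpa [diffOp, h, Pi.sub_def] using (ih α).sub (ih _)

theorem memLp_mixedDiff {d : ℕ} {Ω : Type*} [MeasurableSpace Ω] {μ : Measure Ω}
    {p : ENNReal} {S : (Fin d → ℕ) → Ω → ℝ} (hS : ∀ α, MemLp (S α) p μ)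
    (α : Fin d → ℕ) : MemLp (fun ω => mixedDiff (fun β => S β ω) α) p μ :=
  memLp_diffOp_foldr hS _ α

/-- Integrating a function of `X` against the indicator of an independent event `{N ∈ A}`. -/
theorem ProbabilityTheory.IndepFun.integral_mul_indicator_preimage
    {Ω E F : Type*} [MeasurableSpace Ω] [MeasurableSpace E] [MeasurableSpace F]
    {μ : Measure Ω} {N : Ω → E} {X : Ω → F} (hind : IndepFun N X μ) (hN : Measurable N)
    {A : Set E} (hA : MeasurableSet A) {g : F → ℝ} (hg : Measurable g)
    (hgX : AEStronglyMeasurable (fun ω => g (X ω)) μ) :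
    ∫ ω, g (X ω) * (N ⁻¹' A).indicator 1 ω ∂μ = (∫ ω, g (X ω) ∂μ) * (μ (N ⁻¹' A)).toReal := by
  have hAm : MeasurableSet (N ⁻¹' A) := hN hA
  have h : IndepFun (fun ω => g (X ω)) ((N ⁻¹' A).indicator (1 : Ω → ℝ)) μ :=
    hind.symm.comp hg (measurable_one.indicator hA : Measurable (A.indicator (1 : E → ℝ)))
  rw [h.integral_fun_mul_eq_mul_integral hgX
    (measurable_one.indicator hAm).aestronglyMeasurable, integral_indicator_one hAm,
    measureReal_def]

/-- exact second moment of the partial coupled-sum estimator: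
`E[Z̄_n²] = Σ_{α,β ∈ I_0^n} E[ΔS_α ΔS_β] P(N ≥ α ∨ β)/(P(N ≥ α) P(N ≥ β))`. -/
theorem secondMoment_partial_estimator {d : ℕ} (hd : 1 ≤ d)
    {Ω : Type*} [MeasureSpace Ω] [IsProbabilityMeasure (ℙ : Measure Ω)]
    (S : (Fin d → ℕ) → Ω → ℝ) (hS : ∀ α, MemLp (S α) 2 ℙ)
    (n : ℕ)
    (N : Ω → (Fin d → ℕ)) (hN : Measurable N)
    (hind : IndepFun N (fun ω => fun α => S α ω) ℙ)
    (hpos : ∀ α ∈ Finset.Iic ((fun _ => n) : Fin d → ℕ), 0 < ℙ {ω | α ≤ N ω}) :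
    ∫ ω, (∑ α ∈ Finset.Iic ((fun _ => n) : Fin d → ℕ),
        mixedDiff (fun β => S β ω) α * Set.indicator {ω' | α ≤ N ω'} 1 ω
          / (ℙ {ω' | α ≤ N ω'}).toReal) ^ 2 ∂ℙ
      = ∑ α ∈ Finset.Iic ((fun _ => n) : Fin d → ℕ),
          ∑ β ∈ Finset.Iic ((fun _ => n) : Fin d → ℕ),
            (∫ ω, mixedDiff (fun γ => S γ ω) α * mixedDiff (fun γ => S γ ω) β ∂ℙ)
              * (ℙ {ω | α ⊔ β ≤ N ω}).toReal
              / ((ℙ {ω | α ≤ N ω}).toReal * (ℙ {ω | β ≤ N ω}).toReal) := by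
  set c : (Fin d → ℕ) → ℝ := fun α => (ℙ {ω | α ≤ N ω}).toReal
  set D : (Fin d → ℕ) → Ω → ℝ := fun α ω => mixedDiff (fun γ => S γ ω) α
  have hDD (α β) : Integrable (fun ω => D α ω * D β ω) ℙ :=
    (memLp_mixedDiff hS α).integrable_mul (memLp_mixedDiff hS β)
  have hmeas (α : Fin d → ℕ) : MeasurableSet {ω | α ≤ N ω} := hN measurableSet_Ici
  have hind_sup (α β : Fin d → ℕ) (ω : Ω) :
      Set.indicator {ω' | α ≤ N ω'} (1 : Ω → ℝ) ω * Set.indicator {ω' | β ≤ N ω'} 1 ω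
        = Set.indicator {ω' | α ⊔ β ≤ N ω'} 1 ω := by
    by_cases h₁ : α ≤ N ω <;> by_cases h₂ : β ≤ N ω <;> simp [Set.indicator, h₁, h₂]
  have hsq (ω : Ω) :
      (∑ α ∈ Finset.Iic ((fun _ => n) : Fin d → ℕ),
        D α ω * Set.indicator {ω' | α ≤ N ω'} 1 ω / c α) ^ 2
      = ∑ α ∈ Finset.Iic ((fun _ => n) : Fin d → ℕ),
          ∑ β ∈ Finset.Iic ((fun _ => n) : Fin d → ℕ),
            D α ω * D β ω * Set.indicator {ω' | α ⊔ β ≤ N ω'} 1 ω / (c α * c β) := by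
    rw [sq, Finset.sum_mul_sum]
    refine Finset.sum_congr rfl fun α _ => Finset.sum_congr rfl fun β _ => ?_
    rw [← hind_sup, div_mul_div_comm]
    ring
  have hint (α β) : Integrable (fun ω =>
      D α ω * D β ω * Set.indicator {ω' | α ⊔ β ≤ N ω'} 1 ω / (c α * c β)) ℙ := by
    refine Integrable.div_const ?_ _
    refine ((hDD α β).indicator (hmeas (α ⊔ β))).congr (.of_forall fun ω => ?_)
    simp [Set.indicator]
  simp_rw [show ∀ α ω, mixedDiff (fun β => S β ω) α = D α ω from fun _ _ => rfl,
    show ∀ α, (ℙ {ω | α ≤ N ω}).toReal = c α from fun _ => rfl, hsq]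
  rw [integral_finsetSum _ fun α _ => integrable_finsetSum _ fun β _ => hint α β]
  refine Finset.sum_congr rfl fun α _ => ?_
  rw [integral_finsetSum _ fun β _ => hint α β]
  refine Finset.sum_congr rfl fun β _ => ?_
  rw [integral_div]
  congr 1
  exact hind.integral_mul_indicator_preimage hN (measurableSet_Ici (a := α ⊔ β))
    ((measurable_mixedDiff α).mul (measurable_mixedDiff β)) (hDD α β).aestronglyMeasurable
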